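/- arXiv:1401.0562 — 6 statements merged into one kernel-verified Lean document; each statement's English description precedes it below -/
import Mathlib

section
/- Let σ > 0, μ ∈ ℝ, γ > 0 with γ ≠ 1, δ ∈ ℝ, and let V be twice differentiable at a point L > 0 with L ≠ −1. Suppose V satisfies the no-trade ODE at L, i.e. (1/2)σ²L²V''(L) + μL V'(L) − (1−γ)δ V(L) = 0, together with the two smooth-pasting conditions at the buy boundary: (1+L)V'(L) − (1−γ)V(L) = 0 and (1+L)V''(L) + γV'(L) = 0. If V(L) ≠ 0, then the proportion π₋ := L/(1+L) satisfies the quadratic equation (1/2)γσ²π₋² − μπ₋ + δ = 0. -/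
/-- If `V` is twice differentiable at the buy boundary `L > 0`, `L ≠ −1`,
satisfies the no-trade ODE at `L` together with the two smooth-pasting conditions at the buy
boundary, and `V(L) ≠ 0`, then `π₋ = L/(1+L)` solves `(1/2)γσ²π² − μπ + δ = 0`. -/
theorem buy_boundary_proportion_quadratic (σ μ γ δ L : ℝ) (V : ℝ → ℝ)
    (hσ : 0 < σ) (hγ : 0 < γ) (hγ1 : γ ≠ 1) (hL : 0 < L) (hL1 : L ≠ -1)
    (hV1 : DifferentiableAt ℝ V L) (hV2 : DifferentiableAt ℝ (deriv V) L)
    (hODE : (1/2) * σ^2 * L^2 * deriv (deriv V) L + μ * L * deriv V L - (1 - γ) * δ * V L = 0)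
    (hbc1 : (1 + L) * deriv V L - (1 - γ) * V L = 0)
    (hbc2 : (1 + L) * deriv (deriv V) L + γ * deriv V L = 0)
    (hVL : V L ≠ 0) :
    (1/2) * γ * σ^2 * (L / (1 + L))^2 - μ * (L / (1 + L)) + δ = 0 := by
  have hP : 1 + L ≠ 0 := by positivity
  have hQ : (1 - γ) * V L *
      ((1/2) * γ * σ^2 * L^2 - μ * L * (1 + L) + δ * (1 + L)^2) = 0 := by
    linear_combination -(1 + L)^2 * hODE + (1/2) * σ^2 * L^2 * (1 + L) * hbc2
      - ((1/2) * σ^2 * L^2 * γ - μ * L * (1 + L)) * hbc1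
  have hQ' := (mul_eq_zero.mp hQ).resolve_left (mul_ne_zero (sub_ne_zero.mpr hγ1.symm) hVL)
  have hdiv : (1/2) * γ * σ^2 * (L / (1 + L))^2 - μ * (L / (1 + L)) + δ =
      ((1/2) * γ * σ^2 * L^2 - μ * L * (1 + L) + δ * (1 + L)^2) / (1 + L)^2 := by
    field_simp
  rw [hdiv, hQ', zero_div]
end

section
/- Let σ > 0, μ ∈ ℝ, γ > 0 with γ ≠ 1, δ ∈ ℝ, λ ∈ (0,1), and let V be twice differentiable at a point U > 0. Suppose V satisfies the no-trade ODE at U, i.e. (1/2)σ²U²V''(U) + μU V'(U) − (1−γ)δ V(U) = 0, together with the two smooth-pasting conditions at the sell boundary: (1/(1−λ) + U)V'(U) − (1−γ)V(U) = 0 and (1/(1−λ) + U)V''(U) + γV'(U) = 0. If V(U) ≠ 0, then the proportion π₊ := U/(1/(1−λ) + U) satisfies the quadratic equation (1/2)γσ²π₊² − μπ₊ + δ = 0. -/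
/-- If `V` is twice differentiable at the sell boundary `U > 0`, satisfies the
no-trade ODE at `U` together with the two smooth-pasting conditions at the sell boundary (with
transaction cost `λ ∈ (0,1)`), and `V(U) ≠ 0`, then `π₊ = U/(1/(1−λ)+U)` solves
`(1/2)γσ²π² − μπ + δ = 0`. -/
theorem sell_boundary_proportion_quadratic (σ μ γ δ lam U : ℝ) (V : ℝ → ℝ)
    (hσ : 0 < σ) (hγ : 0 < γ) (hγ1 : γ ≠ 1) (hlam0 : 0 < lam) (hlam1 : lam < 1) (hU : 0 < U)
    (hV1 : DifferentiableAt ℝ V U) (hV2 : DifferentiableAt ℝ (deriv V) U)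
    (hODE : (1/2) * σ^2 * U^2 * deriv (deriv V) U + μ * U * deriv V U - (1 - γ) * δ * V U = 0)
    (hbc1 : (1 / (1 - lam) + U) * deriv V U - (1 - γ) * V U = 0)
    (hbc2 : (1 / (1 - lam) + U) * deriv (deriv V) U + γ * deriv V U = 0)
    (hVU : V U ≠ 0) :
    (1/2) * γ * σ^2 * (U / (1 / (1 - lam) + U))^2 - μ * (U / (1 / (1 - lam) + U)) + δ = 0 := by
  have ha : 0 < 1 / (1 - lam) + U := add_pos (one_div_pos.2 (sub_pos.2 hlam1)) hU
  generalize 1 / (1 - lam) + U = a at *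
  have hne : (1 - γ) * V U ≠ 0 := mul_ne_zero (sub_ne_zero.2 hγ1.symm) hVU
  have hquad : (1/2) * γ * σ^2 * U^2 - μ * U * a + δ * a^2 = 0 := by
    apply mul_left_cancel₀ hne
    linear_combination (-a^2) * hODE + ((1/2) * σ^2 * U^2 * a) * hbc2 +
      (μ * U * a - (1/2) * σ^2 * U^2 * γ) * hbc1
  have hdiv : (1/2) * γ * σ^2 * (U / a)^2 - μ * (U / a) + δ =
      ((1/2) * γ * σ^2 * U^2 - μ * U * a + δ * a^2) / a^2 := by
    field_simp
  rw [hdiv, hquad, zero_div]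
end

section
/- Let σ > 0, μ ∈ ℝ, γ ≠ 1, λ ∈ (0,1), k := μ/((1/2)σ²), 0 < ℓ < u, and let w, v be differentiable at ℓ and u. Suppose w satisfies ℓ w'(ℓ) − k₋w(ℓ) = 0 and u w'(u) − k₊w(u) = 0, where k₋ = (1−γ)ℓ/(1+ℓ) + (k−2) and k₊ = (1−γ)u/(1/(1−λ)+u) + (k−2), and suppose v satisfies (1+ℓ)v'(ℓ) − (1−γ)v(ℓ) = 0 and (1/(1−λ)+u)v'(u) − (1−γ)v(u) = 0. Then the boundary bracket vanishes: [ (1/2)σ² v'(ζ)ζ²w(ζ) − (1/2)σ² (ζ²w(ζ))' v(ζ) + μζ w(ζ)v(ζ) ]_{ζ=ℓ}^{ζ=u} = 0, i.e. the expression evaluated at u equals the expression evaluated at ℓ (both being zero). -/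
/-- The boundary bracket vanishes at a point `x` where `(c + x) v' = g v` and
`x w' = (g x / (c + x) + k - 2) w`. -/
theorem bracket_eq_zero_of_boundary_conditions {s μ g k c x : ℝ} {w v : ℝ → ℝ}
    (hμ : μ = k * s) (hc : c + x ≠ 0) (hw : DifferentiableAt ℝ w x)
    (hwbc : x * deriv w x - (g * (x / (c + x)) + (k - 2)) * w x = 0)
    (hvbc : (c + x) * deriv v x - g * v x = 0) :
    s * deriv v x * x ^ 2 * w x - s * deriv (fun y => y ^ 2 * w y) x * v x
      + μ * x * w x * v x = 0 := by
  have hd : deriv (fun y => y ^ 2 * w y) x = 2 * x * w x + x ^ 2 * deriv w x := by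
    simpa using ((hasDerivAt_pow 2 x).fun_mul hw.hasDerivAt).deriv
  have hr : x / (c + x) * (c + x) = x := div_mul_cancel₀ x hc
  have hv : x * deriv v x = g * (x / (c + x)) * v x := by
    linear_combination x / (c + x) * hvbc - deriv v x * hr
  rw [hd, hμ]
  linear_combination s * x * w x * hv - s * x * v x * hwbc


/-- If `w` satisfies the adjoint mixed boundary conditions
`ℓw'(ℓ) = k₋w(ℓ)`, `uw'(u) = k₊w(u)` with `k₋ = (1−γ)ℓ/(1+ℓ) + (k−2)`,
`k₊ = (1−γ)u/(1/(1−λ)+u) + (k−2)`, `k = μ/((1/2)σ²)`, and `v` satisfies the buy and sell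
boundary conditions, then the boundary bracket
`(1/2)σ² v'ζ²w − (1/2)σ²(ζ²w)'v + μζwv` vanishes at both `ℓ` and `u`. -/
theorem boundary_bracket_vanishes (σ μ γ lam k ℓ u : ℝ) (w v : ℝ → ℝ)
    (hσ : 0 < σ) (hγ1 : γ ≠ 1) (hlam0 : 0 < lam) (hlam1 : lam < 1)
    (hℓ : 0 < ℓ) (hℓu : ℓ < u) (hk : k = μ / ((1/2) * σ^2))
    (hwℓ : DifferentiableAt ℝ w ℓ) (hwu : DifferentiableAt ℝ w u)
    (hvℓ : DifferentiableAt ℝ v ℓ) (hvu : DifferentiableAt ℝ v u)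
    (hwbcℓ : ℓ * deriv w ℓ - ((1 - γ) * (ℓ / (1 + ℓ)) + (k - 2)) * w ℓ = 0)
    (hwbcu : u * deriv w u - ((1 - γ) * (u / (1 / (1 - lam) + u)) + (k - 2)) * w u = 0)
    (hvbcℓ : (1 + ℓ) * deriv v ℓ - (1 - γ) * v ℓ = 0)
    (hvbcu : (1 / (1 - lam) + u) * deriv v u - (1 - γ) * v u = 0) :
    ((1/2) * σ^2 * deriv v ℓ * ℓ^2 * w ℓ
        - (1/2) * σ^2 * deriv (fun x => x^2 * w x) ℓ * v ℓ + μ * ℓ * w ℓ * v ℓ = 0)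
    ∧ ((1/2) * σ^2 * deriv v u * u^2 * w u
        - (1/2) * σ^2 * deriv (fun x => x^2 * w x) u * v u + μ * u * w u * v u = 0) := by
  have hμ : μ = k * ((1/2) * σ^2) := by
    rw [hk, div_mul_cancel₀ _ (by positivity)]
  have hu : 0 < u := hℓ.trans hℓu
  have hc : 0 < 1 / (1 - lam) := one_div_pos.2 (sub_pos.2 hlam1)
  exact ⟨bracket_eq_zero_of_boundary_conditions hμ (by positivity) hwℓ hwbcℓ hvbcℓ,
    bracket_eq_zero_of_boundary_conditions hμ (add_pos hc hu).ne' hwu hwbcu hvbcu⟩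
end

section
/- Let σ > 0, μ ∈ ℝ, γ > 0 with γ ≠ 1, δ₀, δ₁, V₃ ∈ ℝ, λ ∈ (0,1), 0 < ℓ < u, k := μ/((1/2)σ²). Let v⁰ be twice continuously differentiable on [ℓ,u], satisfying the homogeneous no-trade ODE (1/2)σ²ζ²(v⁰)'' + μζ(v⁰)' − (1−γ)δ₀v⁰ = 0 on [ℓ,u] together with the boundary conditions (1+ℓ)(v⁰)'(ℓ) − (1−γ)v⁰(ℓ) = 0 and (1/(1−λ)+u)(v⁰)'(u) − (1−γ)v⁰(u) = 0, and set w(ζ) := ζ^{k−2}v⁰(ζ). Let v¹ be twice continuously differentiable on [ℓ,u], satisfying the inhomogeneous equation (1/2)σ²ζ²(v¹)'' + μζ(v¹)' − (1−γ)δ₀v¹ = −V₃·ζ∂_ζ(ζ²∂²_{ζζ}v⁰) + (1−γ)δ₁v⁰ on [ℓ,u] with boundary conditions (1+ℓ)(v¹)'(ℓ) − (1−γ)v¹(ℓ) = 0 and (1/(1−λ)+u)(v¹)'(u) − (1−γ)v¹(u) = 0. If ∫_ℓ^u w(ζ)v⁰(ζ) dζ ≠ 0, then δ₁ = (V₃/(1−γ))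 · ( ∫_ℓ^u w(ζ)·ζ∂_ζ(ζ²∂²_{ζζ}v⁰(ζ)) dζ ) / ( ∫_ℓ^u w(ζ)v⁰(ζ) dζ ). -/
open Set intervalIntegral

theorem ContDiffAt.deriv_one_of_two {f : ℝ → ℝ} {x : ℝ} (hf : ContDiffAt ℝ 2 f x) :
    ContDiffAt ℝ 1 (deriv f) x := by
  have h : ContDiffAt ℝ 1 (fderiv ℝ f) x := hf.fderiv_right (by norm_num)
  exact h.clm_apply contDiffAt_const

theorem ContDiffAt.hasDerivAt_deriv_of_two {f : ℝ → ℝ} {x : ℝ} (hf : ContDiffAt ℝ 2 f x) :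
    HasDerivAt (deriv f) (deriv (deriv f) x) x :=
  (hf.deriv_one_of_two.differentiableAt (by norm_num)).hasDerivAt

theorem ContDiffAt.continuousAt_deriv_deriv_of_two {f : ℝ → ℝ} {x : ℝ}
    (hf : ContDiffAt ℝ 2 f x) : ContinuousAt (deriv (deriv f)) x := by
  have h : ContDiffAt ℝ 0 (fderiv ℝ (deriv f)) x :=
    hf.deriv_one_of_two.fderiv_right (by norm_num)
  exact (h.clm_apply contDiffAt_const (g := fun _ => (1 : ℝ))).continuousAt

/-- Derivative of the weighted Wronskian `x ^ k * (f * g' - f' * g)`. -/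
theorem hasDerivAt_rpow_mul_wronskian {f g : ℝ → ℝ} {k x : ℝ} (hx : 0 < x)
    (hf : ContDiffAt ℝ 2 f x) (hg : ContDiffAt ℝ 2 g x) :
    HasDerivAt (fun y => y ^ k * (f y * deriv g y - deriv f y * g y))
      (x ^ (k - 2) * (f x * (x ^ 2 * deriv (deriv g) x + k * x * deriv g x)
        - g x * (x ^ 2 * deriv (deriv f) x + k * x * deriv f x))) x := by
  have hf' := (hf.differentiableAt (by norm_num)).hasDerivAt
  have hg' := (hg.differentiableAt (by norm_num)).hasDerivAt
  have h := (Real.hasDerivAt_rpow_const (p := k) (Or.inl hx.ne')).mul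
    ((hf'.mul hg.hasDerivAt_deriv_of_two).sub (hf.hasDerivAt_deriv_of_two.mul hg'))
  refine h.congr_deriv ?_
  have h1 : x ^ (k - 1) = x ^ (k - 2) * x := by
    rw [← Real.rpow_add_one hx.ne']; ring_nf
  have h2 : x ^ k = x ^ (k - 2) * x ^ 2 := by
    rw [← Real.rpow_natCast x 2, ← Real.rpow_add hx]; norm_num
  simp only [Pi.mul_apply, Pi.sub_apply]
  rw [h1, h2]
  ring

/-- Two functions with the same Robin boundary condition have vanishing Wronskian there. -/
theorem wronskian_eq_zero_of_robin {a b f f' g g' : ℝ} (ha : a ≠ 0)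
    (hf : a * f' - b * f = 0) (hg : a * g' - b * g = 0) : f * g' - f' * g = 0 := by
  refine (mul_eq_zero.mp ?_).resolve_left ha
  linear_combination f * hg - g * hf


/-- Fredholm solvability condition determining the first-order growth-rate
correction `δ₁` in the fast-scale expansion: if `v⁰` solves the homogeneous no-trade problem
with growth rate `δ₀` and free boundaries `ℓ < u`, `w(ζ) = ζ^{k−2}v⁰(ζ)` with
`k = μ/((1/2)σ²)`, and `v¹` solves the inhomogeneous problem with source
`−V₃·D₁D₂v⁰ + (1−γ)δ₁v⁰` (where `D₁D₂v⁰ = ζ∂_ζ(ζ²∂²_{ζζ}v⁰)`) and the same boundary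
conditions, then `δ₁ = (V₃/(1−γ)) · ∫ w·D₁D₂v⁰ / ∫ w·v⁰`. -/
theorem fast_scale_delta1 (σ μ γ δ₀ δ₁ V₃ lam ℓ u k : ℝ) (v0 v1 : ℝ → ℝ)
    (hσ : 0 < σ) (hγ : 0 < γ) (hγ1 : γ ≠ 1) (hlam0 : 0 < lam) (hlam1 : lam < 1)
    (hℓ : 0 < ℓ) (hℓu : ℓ < u) (hk : k = μ / ((1/2) * σ^2))
    (hv0 : ∀ x ∈ Set.Icc ℓ u, ContDiffAt ℝ 2 v0 x)
    (hODE0 : ∀ ζ ∈ Set.Icc ℓ u,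
      (1/2) * σ^2 * ζ^2 * deriv (deriv v0) ζ + μ * ζ * deriv v0 ζ - (1 - γ) * δ₀ * v0 ζ = 0)
    (hbc0ℓ : (1 + ℓ) * deriv v0 ℓ - (1 - γ) * v0 ℓ = 0)
    (hbc0u : (1 / (1 - lam) + u) * deriv v0 u - (1 - γ) * v0 u = 0)
    (hv1 : ∀ x ∈ Set.Icc ℓ u, ContDiffAt ℝ 2 v1 x)
    (hODE1 : ∀ ζ ∈ Set.Icc ℓ u,
      (1/2) * σ^2 * ζ^2 * deriv (deriv v1) ζ + μ * ζ * deriv v1 ζ - (1 - γ) * δ₀ * v1 ζ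
        = -V₃ * (ζ * deriv (fun x => x^2 * deriv (deriv v0) x) ζ) + (1 - γ) * δ₁ * v0 ζ)
    (hbc1ℓ : (1 + ℓ) * deriv v1 ℓ - (1 - γ) * v1 ℓ = 0)
    (hbc1u : (1 / (1 - lam) + u) * deriv v1 u - (1 - γ) * v1 u = 0)
    (hden : (∫ ζ in ℓ..u, (ζ ^ (k - 2) * v0 ζ) * v0 ζ) ≠ 0) :
    δ₁ = (V₃ / (1 - γ)) *
      (∫ ζ in ℓ..u, (ζ ^ (k - 2) * v0 ζ) * (ζ * deriv (fun x => x^2 * deriv (deriv v0) x) ζ))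
        / (∫ ζ in ℓ..u, (ζ ^ (k - 2) * v0 ζ) * v0 ζ) := by
  have hpos : ∀ x ∈ Icc ℓ u, 0 < x := fun x hx => hℓ.trans_le hx.1
  have hIcc : uIcc ℓ u = Icc ℓ u := uIcc_of_le hℓu.le
  have hμ : (1/2) * σ^2 * k = μ := by rw [hk]; field_simp
  have hγ' : 1 - γ ≠ 0 := sub_ne_zero.mpr hγ1.symm
  have c0 : ContinuousOn v0 (Icc ℓ u) := fun x hx => (hv0 x hx).continuousAt.continuousWithinAt
  have c1 : ContinuousOn v1 (Icc ℓ u) := fun x hx => (hv1 x hx).continuousAt.continuousWithinAt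
  have c0' : ContinuousOn (deriv v0) (Icc ℓ u) := fun x hx =>
    (hv0 x hx).deriv_one_of_two.continuousAt.continuousWithinAt
  have c1' : ContinuousOn (deriv v1) (Icc ℓ u) := fun x hx =>
    (hv1 x hx).deriv_one_of_two.continuousAt.continuousWithinAt
  have c0'' : ContinuousOn (deriv (deriv v0)) (Icc ℓ u) := fun x hx =>
    (hv0 x hx).continuousAt_deriv_deriv_of_two.continuousWithinAt
  have c1'' : ContinuousOn (deriv (deriv v1)) (Icc ℓ u) := fun x hx =>
    (hv1 x hx).continuousAt_deriv_deriv_of_two.continuousWithinAt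
  have cp : ContinuousOn (fun x : ℝ => x ^ (k - 2)) (Icc ℓ u) :=
    continuousOn_id.rpow_const fun x hx => Or.inl (hpos x hx).ne'
  set G' : ℝ → ℝ := fun x =>
    x ^ (k - 2) * (v0 x * (x ^ 2 * deriv (deriv v1) x + k * x * deriv v1 x)
      - v1 x * (x ^ 2 * deriv (deriv v0) x + k * x * deriv v0 x)) with hG'
  have hG'int : IntervalIntegrable G' MeasureTheory.volume ℓ u := by
    apply ContinuousOn.intervalIntegrable
    rw [hIcc]
    fun_prop
  have hint : IntervalIntegrable (fun ζ => (ζ ^ (k - 2) * v0 ζ) * v0 ζ)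
      MeasureTheory.volume ℓ u := by
    apply ContinuousOn.intervalIntegrable
    rw [hIcc]
    fun_prop
  have hwℓ := wronskian_eq_zero_of_robin (by positivity) hbc0ℓ hbc1ℓ
  have hu : 1 / (1 - lam) + u ≠ 0 := by
    have h1 : 0 < 1 - lam := sub_pos.mpr hlam1
    have h2 : 0 < u := hℓ.trans hℓu
    positivity
  have hwu := wronskian_eq_zero_of_robin hu hbc0u hbc1u
  have hG : ∫ x in ℓ..u, G' x = 0 := by
    rw [integral_eq_sub_of_hasDerivAt (fun x hx => ?_) hG'int
      (f := fun y => y ^ k * (v0 y * deriv v1 y - deriv v0 y * v1 y))]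
    · simp only [hwℓ, hwu, mul_zero, sub_zero]
    · rw [hIcc] at hx
      exact hasDerivAt_rpow_mul_wronskian (hpos x hx) (hv0 x hx) (hv1 x hx)
  have key : V₃ * (∫ ζ in ℓ..u, (ζ ^ (k - 2) * v0 ζ) *
        (ζ * deriv (fun x => x^2 * deriv (deriv v0) x) ζ))
      = (1 - γ) * δ₁ * ∫ ζ in ℓ..u, (ζ ^ (k - 2) * v0 ζ) * v0 ζ := by
    calc
      _ = ∫ ζ in ℓ..u, ((1 - γ) * δ₁ * ((ζ ^ (k - 2) * v0 ζ) * v0 ζ)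
            - (1/2) * σ^2 * G' ζ) := by
        rw [← integral_const_mul]
        refine integral_congr fun ζ hζ => ?_
        rw [hIcc] at hζ
        simp only [hG']
        linear_combination ζ ^ (k - 2) * v0 ζ * hODE1 ζ hζ
          - ζ ^ (k - 2) * v1 ζ * hODE0 ζ hζ
          + ζ ^ (k - 2) * ζ * (v0 ζ * deriv v1 ζ - v1 ζ * deriv v0 ζ) * hμ
      _ = _ := by
        rw [integral_sub (hint.const_mul _) (hG'int.const_mul _), integral_const_mul,
          integral_const_mul, hG, mul_zero, sub_zero]
  rw [eq_div_iff hden, div_mul_eq_mul_div, key]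
  field_simp
end

section
/- Let σ > 0, μ ∈ ℝ, γ ≠ 1, δ₀, δ₁, V₃, C₊, ξ, c₊, c₋ ∈ ℝ, and let θ₊ ≠ θ₋ be real roots of the characteristic quadratic (1/2)σ²θ² + (μ − (1/2)σ²)θ − (1−γ)δ₀ = 0. Set Δθ := θ₊ − θ₋, L_± := (θ_± − 1)θ_±², and c̃_± := −c_±((1−γ)δ₁ − V₃L_±)/((1/2)σ²Δθ). Then the function v¹(ζ) := C₊ζ^{θ₊} − c̃₊ζ^{θ₊}log ζ + c̃₋ζ^{θ₋}log ζ + ξ(c₊ζ^{θ₊} + c₋ζ^{θ₋}) satisfies, for all ζ > 0, (1/2)σ²ζ²(v¹)''(ζ) + μζ(v¹)'(ζ) − (1−γ)δ₀v¹(ζ) = −V₃·(L₊c₊ζ^{θ₊} + L₋c₋ζ^{θ₋}) + (1−γ)δ₁·(c₊ζ^{θ₊} + c₋ζ^{θ₋}). -/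
/-- The explicit first-order correction in the fast-scale case with real roots:
`v¹(ζ) = C₊ζ^{θ₊} − c̃₊ζ^{θ₊}log ζ + c̃₋ζ^{θ₋}log ζ + ξ(c₊ζ^{θ₊} + c₋ζ^{θ₋})` where
`c̃_± = −c_±((1−γ)δ₁ − V₃(θ_±−1)θ_±²)/((1/2)σ²(θ₊−θ₋))`. -/
noncomputable def v1fast (σ γ δ₁ V₃ Cp ξ cp cm θp θm : ℝ) (ζ : ℝ) : ℝ :=
  Cp * ζ ^ θp
    - (-(cp * ((1 - γ) * δ₁ - V₃ * ((θp - 1) * θp^2)) / ((1/2) * σ^2 * (θp - θm))))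
        * ζ ^ θp * Real.log ζ
    + (-(cm * ((1 - γ) * δ₁ - V₃ * ((θm - 1) * θm^2)) / ((1/2) * σ^2 * (θp - θm))))
        * ζ ^ θm * Real.log ζ
    + ξ * (cp * ζ ^ θp + cm * ζ ^ θm)

/-- The function `x ↦ (a + b log x) x^θ`; this family is closed under differentiation on `(0,∞)`. -/
noncomputable def rpowLog (a b θ x : ℝ) : ℝ := (a + b * Real.log x) * x ^ θ

theorem hasDerivAt_rpowLog (a b θ : ℝ) {x : ℝ} (hx : 0 < x) :
    HasDerivAt (rpowLog a b θ) (rpowLog (a * θ + b) (b * θ) (θ - 1) x) x := by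
  have h := (((Real.hasDerivAt_log hx.ne').const_mul b).const_add a).mul
    (Real.hasDerivAt_rpow_const (p := θ) (Or.inl hx.ne'))
  refine h.congr_deriv ?_
  rw [rpowLog, Real.rpow_sub_one hx.ne']
  field_simp
  ring

/-- Derivative of a sum of two members of the family `rpowLog`. -/
theorem deriv_rpowLog_add (a b θ a' b' θ' : ℝ) {x : ℝ} (hx : 0 < x) :
    deriv (fun y => rpowLog a b θ y + rpowLog a' b' θ' y) x =
      rpowLog (a * θ + b) (b * θ) (θ - 1) x + rpowLog (a' * θ' + b') (b' * θ') (θ' - 1) x :=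
  ((hasDerivAt_rpowLog a b θ hx).add (hasDerivAt_rpowLog a' b' θ' hx)).deriv

theorem deriv_deriv_rpowLog_add (a b θ a' b' θ' : ℝ) {x : ℝ} (hx : 0 < x) :
    deriv (deriv fun y => rpowLog a b θ y + rpowLog a' b' θ' y) x =
      rpowLog ((a * θ + b) * (θ - 1) + b * θ) (b * θ * (θ - 1)) (θ - 1 - 1) x +
        rpowLog ((a' * θ' + b') * (θ' - 1) + b' * θ') (b' * θ' * (θ' - 1)) (θ' - 1 - 1) x := by
  have h : deriv (fun y => rpowLog a b θ y + rpowLog a' b' θ' y) =ᶠ[nhds x] fun y =>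
      rpowLog (a * θ + b) (b * θ) (θ - 1) y + rpowLog (a' * θ' + b') (b' * θ') (θ' - 1) y := by
    filter_upwards [lt_mem_nhds hx] with y hy using deriv_rpowLog_add a b θ a' b' θ' hy
  rw [h.deriv_eq, deriv_rpowLog_add _ _ _ _ _ _ hx]

/-- At a root `θ` of the indicial polynomial `k θ² + (μ - k) θ - r`, the Euler operator
`k x² ∂² + μ x ∂ - r` sends `(a + b log x) x^θ` to `b (2 k θ + μ - k) x^θ`. -/
theorem euler_rpowLog_of_root {k μ r θ : ℝ} (hroot : k * θ ^ 2 + (μ - k) * θ - r = 0)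
    (a b : ℝ) {x : ℝ} (hx : 0 < x) :
    k * x ^ 2 * rpowLog ((a * θ + b) * (θ - 1) + b * θ) (b * θ * (θ - 1)) (θ - 1 - 1) x
        + μ * x * rpowLog (a * θ + b) (b * θ) (θ - 1) x - r * rpowLog a b θ x
      = b * (2 * k * θ + μ - k) * x ^ θ := by
  simp only [rpowLog, Real.rpow_sub_one hx.ne']
  field_simp
  linear_combination (a + b * Real.log x) * hroot

/-- If `θ₊ ≠ θ₋` are real roots of the characteristic quadratic with
eigenvalue `δ₀`, then `v¹ = v1fast ...` satisfies
`L_NT(σ;δ₀)v¹ = −V₃(L₊c₊ζ^{θ₊} + L₋c₋ζ^{θ₋}) + (1−γ)δ₁(c₊ζ^{θ₊} + c₋ζ^{θ₋})` on `(0,∞)`. -/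
theorem fast_scale_v1_real (σ μ γ δ₀ δ₁ V₃ Cp ξ cp cm θp θm : ℝ)
    (hσ : 0 < σ) (hγ1 : γ ≠ 1) (hθ : θp ≠ θm)
    (hrootp : (1/2) * σ^2 * θp^2 + (μ - (1/2) * σ^2) * θp - (1 - γ) * δ₀ = 0)
    (hrootm : (1/2) * σ^2 * θm^2 + (μ - (1/2) * σ^2) * θm - (1 - γ) * δ₀ = 0) :
    ∀ ζ : ℝ, 0 < ζ →
      (1/2) * σ^2 * ζ^2 * deriv (deriv (v1fast σ γ δ₁ V₃ Cp ξ cp cm θp θm)) ζ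
        + μ * ζ * deriv (v1fast σ γ δ₁ V₃ Cp ξ cp cm θp θm) ζ
        - (1 - γ) * δ₀ * v1fast σ γ δ₁ V₃ Cp ξ cp cm θp θm ζ
      = -V₃ * ((θp - 1) * θp^2 * cp * ζ ^ θp + (θm - 1) * θm^2 * cm * ζ ^ θm)
        + (1 - γ) * δ₁ * (cp * ζ ^ θp + cm * ζ ^ θm) := by
  have hd : θp - θm ≠ 0 := sub_ne_zero.mpr hθ
  have hsum : (1/2) * σ^2 * (θp + θm) + (μ - (1/2) * σ^2) = 0 :=
    mul_left_cancel₀ hd (by linear_combination hrootp - hrootm)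
  intro ζ hζ
  set A := cp * ((1 - γ) * δ₁ - V₃ * ((θp - 1) * θp^2)) / ((1/2) * σ^2 * (θp - θm)) with hA
  set B := -(cm * ((1 - γ) * δ₁ - V₃ * ((θm - 1) * θm^2)) / ((1/2) * σ^2 * (θp - θm))) with hB
  have hAmul : A * ((1/2) * σ^2 * (θp - θm)) =
      cp * ((1 - γ) * δ₁ - V₃ * ((θp - 1) * θp^2)) := by
    rw [hA]; field_simp
  have hBmul : B * ((1/2) * σ^2 * (θp - θm)) =
      -(cm * ((1 - γ) * δ₁ - V₃ * ((θm - 1) * θm^2))) := by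
    rw [hB]; field_simp
  have hv : v1fast σ γ δ₁ V₃ Cp ξ cp cm θp θm =
      fun y => rpowLog (Cp + ξ * cp) A θp y + rpowLog (ξ * cm) B θm y := by
    funext y
    simp only [v1fast, rpowLog, hA, hB]
    ring
  rw [hv, deriv_deriv_rpowLog_add _ _ _ _ _ _ hζ, deriv_rpowLog_add _ _ _ _ _ _ hζ]
  linear_combination euler_rpowLog_of_root hrootp (Cp + ξ * cp) A hζ
    + euler_rpowLog_of_root hrootm (ξ * cm) B hζ
    + (A * ζ ^ θp + B * ζ ^ θm) * hsum + ζ ^ θp * hAmul - ζ ^ θm * hBmul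
end

section
/- Let γ ≠ 1 and let I ⊆ ℝ be an open interval of volatility parameters. Suppose L : I → ℝ is differentiable, V : (0,∞) × I → ℝ is such that ∂_ζV, ∂²_{ζζ}V and the mixed partial ∂_σ∂_ζV exist and ∂_σV, ∂_ζV are differentiable in the relevant variables, and suppose that for every σ ∈ I the two smooth-pasting conditions hold at the moving boundary: (1 + L(σ))·∂_ζV(L(σ), σ) − (1−γ)·V(L(σ), σ) = 0 and (1 + L(σ))·∂²_{ζζ}V(L(σ), σ) + γ·∂_ζV(L(σ), σ) = 0. Then the Vega ν(ζ) := ∂_σV(ζ, σ) satisfies the homogeneous Neumann-type boundary condition (1 + L(σ))·ν'(L(σ)) − (1−γ)·ν(L(σ)) = 0 for every σ ∈ I (where ν' = ∂_ζ∂_σV). -/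
section PartialDerivatives

variable {E : Type*} [NormedAddCommGroup E] [NormedSpace ℝ E]

/-- The first partial derivative of a differentiable function on the plane. -/
lemma hasDerivAt_fst_of_differentiable {F : ℝ × ℝ → E} (hF : Differentiable ℝ F) (x s : ℝ) :
    HasDerivAt (fun y => F (y, s)) (fderiv ℝ F (x, s) (1, 0)) x :=
  (hF (x, s)).hasFDerivAt.comp_hasDerivAt x ((hasDerivAt_id x).prodMk (hasDerivAt_const x s))

/-- The second partial derivative of a differentiable function on the plane. -/
lemma hasDerivAt_snd_of_differentiable {F : ℝ × ℝ → E} (hF : Differentiable ℝ F) (x s : ℝ) :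
    HasDerivAt (fun t => F (x, t)) (fderiv ℝ F (x, s) (0, 1)) s :=
  (hF (x, s)).hasFDerivAt.comp_hasDerivAt s ((hasDerivAt_const s x).prodMk (hasDerivAt_id s))

/-- The derivative of a differentiable function on the plane along a moving graph point. -/
lemma hasDerivAt_comp_graph_of_differentiable {F : ℝ × ℝ → E} (hF : Differentiable ℝ F)
    {L : ℝ → ℝ} {l s : ℝ} (hL : HasDerivAt L l s) :
    HasDerivAt (fun t => F (L t, t))
      (l • fderiv ℝ F (L s, s) (1, 0) + fderiv ℝ F (L s, s) (0, 1)) s := by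
  have h := HasFDerivAt.comp_hasDerivAt (f := fun t => (L t, t)) s (hF (L s, s)).hasFDerivAt
    (hL.prodMk (hasDerivAt_id s))
  have hdir : ((l, 1) : ℝ × ℝ) = l • (1, 0) + (0, 1) := by simp
  rwa [hdir, map_add, map_smul] at h

end PartialDerivatives

/-- If the constant-volatility value function `V(ζ,σ)` (smooth, `C²` jointly)
satisfies the two smooth-pasting conditions at the moving buy boundary `L(σ)` for every `σ`
in an open interval `(a,b)` (with `L` differentiable there), then the Vega
`ν(ζ) = ∂_σV(ζ,σ)` inherits the boundary condition
`(1 + L(σ))·ν'(L(σ)) − (1−γ)·ν(L(σ)) = 0` for every `σ ∈ (a,b)`. -/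
theorem vega_inherits_boundary_condition (γ a b : ℝ) (L : ℝ → ℝ) (V : ℝ → ℝ → ℝ)
    (hγ1 : γ ≠ 1)
    (hV : ContDiff ℝ 2 (Function.uncurry V))
    (hL : ∀ σ ∈ Set.Ioo a b, DifferentiableAt ℝ L σ)
    (hbc1 : ∀ σ ∈ Set.Ioo a b,
      (1 + L σ) * deriv (fun ζ => V ζ σ) (L σ) - (1 - γ) * V (L σ) σ = 0)
    (hbc2 : ∀ σ ∈ Set.Ioo a b,
      (1 + L σ) * deriv (deriv (fun ζ => V ζ σ)) (L σ)
        + γ * deriv (fun ζ => V ζ σ) (L σ) = 0) :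
    ∀ σ ∈ Set.Ioo a b,
      (1 + L σ) * deriv (fun ζ => deriv (fun s => V ζ s) σ) (L σ)
        - (1 - γ) * deriv (fun s => V (L σ) s) σ = 0 := by
  intro σ hσ
  set F : ℝ × ℝ → ℝ := Function.uncurry V
  have hF : Differentiable ℝ F := hV.differentiable (by norm_num)
  have hD : Differentiable ℝ (fderiv ℝ F) :=
    (hV.fderiv_right (m := 1) (by norm_num)).differentiable (by norm_num)
  have hsymm := (hV.contDiffAt (x := (L σ, σ))).isSymmSndFDerivAt (by simp) (1, 0) (0, 1)
  have hζ (x s : ℝ) : deriv (fun ζ => V ζ s) x = fderiv ℝ F (x, s) (1, 0) :=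
    (hasDerivAt_fst_of_differentiable hF x s).deriv
  have hs (x s : ℝ) : deriv (fun t => V x t) s = fderiv ℝ F (x, s) (0, 1) :=
    (hasDerivAt_snd_of_differentiable hF x s).deriv
  have hζζ : deriv (deriv (fun ζ => V ζ σ)) (L σ)
      = fderiv ℝ (fderiv ℝ F) (L σ, σ) (1, 0) (1, 0) := by
    rw [funext fun x => hζ x σ]
    simpa using ((hasDerivAt_fst_of_differentiable hD (L σ) σ).clm_apply
      (hasDerivAt_const (L σ) ((1, 0) : ℝ × ℝ))).deriv
  have hsζ : deriv (fun ζ => deriv (fun s => V ζ s) σ) (L σ)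
      = fderiv ℝ (fderiv ℝ F) (L σ, σ) (1, 0) (0, 1) := by
    rw [funext fun x => hs x σ]
    simpa using ((hasDerivAt_fst_of_differentiable hD (L σ) σ).clm_apply
      (hasDerivAt_const (L σ) ((0, 1) : ℝ × ℝ))).deriv
  have hLσ := (hL σ hσ).hasDerivAt
  have hboundary := ((hLσ.const_add 1).mul
    ((hasDerivAt_comp_graph_of_differentiable hD hLσ).clm_apply
      (hasDerivAt_const σ ((1, 0) : ℝ × ℝ)))).sub
    ((hasDerivAt_comp_graph_of_differentiable hF hLσ).const_mul (1 - γ))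
  have hzero := hboundary.unique ((hasDerivAt_const σ (0 : ℝ)).congr_of_eventuallyEq (by
    filter_upwards [isOpen_Ioo.mem_nhds hσ] with t ht
    have h := hbc1 t ht
    rw [hζ] at h
    exact h))
  have h2 := hbc2 σ hσ
  rw [hζζ, hζ] at h2
  rw [hsζ, hs, hsymm]
  simp only [add_apply, smul_apply, smul_eq_mul, map_zero,
    add_zero] at hzero
  linear_combination hzero - deriv L σ * h2
end
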